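/- For every sock ordering ρ of length N and every nonnegative integer k, the set foot^{−k}(ρ) of sock orderings κ such that ρ ∈ foot^k(κ) has cardinality at most C_N^k, where C_N = (1/(N+1))·binom(2N, N) is the N-th Catalan number. -/

import Mathlib

/-- Two words represent the same sock ordering iff they have the same length and the
same pattern of letter equalities. -/
def SockEquiv (w v : List ℕ) : Prop :=
  w.length = v.length ∧ ∀ i j, i < w.length → j < w.length →
    (w.getD i 0 = w.getD j 0 ↔ v.getD i 0 = v.getD j 0)

theorem sockEquiv_refl (w : List ℕ) : SockEquiv w w :=
  ⟨rfl, fun _ _ _ _ => Iff.rfl⟩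

theorem sockEquiv_symm {w v : List ℕ} (h : SockEquiv w v) : SockEquiv v w := by
  obtain ⟨hl, he⟩ := h
  exact ⟨hl.symm, fun i j hi hj => (he i j (by omega) (by omega)).symm⟩

theorem sockEquiv_trans {u v w : List ℕ} (h1 : SockEquiv u v) (h2 : SockEquiv v w) :
    SockEquiv u w := by
  obtain ⟨hl1, he1⟩ := h1
  obtain ⟨hl2, he2⟩ := h2
  exact ⟨hl1.trans hl2, fun i j hi hj =>
    (he1 i j hi hj).trans (he2 i j (by omega) (by omega))⟩

instance sockSetoid : Setoid (List ℕ) :=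
  ⟨SockEquiv, ⟨sockEquiv_refl, sockEquiv_symm, sockEquiv_trans⟩⟩

/-- A sock ordering is an equivalence class of words. -/
def SockOrdering : Type := Quotient sockSetoid

/-- The length of a sock ordering. -/
def SockOrdering.length : SockOrdering → ℕ :=
  Quotient.lift List.length fun _ _ h => h.1

/-- One step of the (nondeterministic) one-stack (one-foot) sorting procedure, acting on
(input, stack, output) triples: push the leftmost input letter onto the stack, or pop
the top letter of the stack onto the right end of the output. -/
inductive StackStep : List ℕ × List ℕ × List ℕ → List ℕ × List ℕ × List ℕ → Prop
  | push (a : ℕ) (inp st out : List ℕ) :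
      StackStep (a :: inp, st, out) (inp, a :: st, out)
  | pop (a : ℕ) (inp st out : List ℕ) :
      StackStep (inp, a :: st, out) (inp, st, out ++ [a])

/-- `out` is obtainable from `w` by one pass through a stack. -/
def IsStackOutput (w out : List ℕ) : Prop :=
  Relation.ReflTransGen StackStep (w, [], []) ([], [], out)

/-- A word has all equal letters consecutive, i.e. it represents a sorted sock ordering. -/
def SortedWordSock (w : List ℕ) : Prop :=
  ∀ i j k, i < j → j < k → k < w.length →
    w.getD i 0 = w.getD k 0 → w.getD i 0 = w.getD j 0

/-- A sock ordering is sorted if some (equivalently, every) word representing it has all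
equal letters consecutive. -/
def SockOrdering.IsSorted (ρ : SockOrdering) : Prop :=
  ∃ w : List ℕ, (⟦w⟧ : SockOrdering) = ρ ∧ SortedWordSock w

/-- `foot ρ` is the set of sock orderings represented by the outputs obtainable by
one pass of foot-sorting applied to a word representing `ρ`. -/
def foot (ρ : SockOrdering) : Set SockOrdering :=
  {κ | ∃ w out : List ℕ, (⟦w⟧ : SockOrdering) = ρ ∧ IsStackOutput w out ∧
    (⟦out⟧ : SockOrdering) = κ}

/-- Iterated foot-sorting: `footIter 0 ρ = {ρ}` and
`footIter (t+1) ρ = ⋃ κ ∈ footIter t ρ, foot κ`. -/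
def footIter : ℕ → SockOrdering → Set SockOrdering
  | 0, ρ => {ρ}
  | t + 1, ρ => ⋃ κ ∈ footIter t ρ, foot κ

/-- A sock ordering is `t`-foot-sortable if `foot^t ρ` contains a sorted sock ordering. -/
def FootSortable (t : ℕ) (ρ : SockOrdering) : Prop :=
  ∃ κ ∈ footIter t ρ, κ.IsSorted

/-- `ρ` has exactly `n` colors. -/
def HasColors (ρ : SockOrdering) (n : ℕ) : Prop :=
  ∃ w : List ℕ, (⟦w⟧ : SockOrdering) = ρ ∧ w.toFinset.card = n

/-- `ρ` is `r`-uniform: every color appears exactly `r` times. -/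
def RUniform (r : ℕ) (ρ : SockOrdering) : Prop :=
  ∃ w : List ℕ, (⟦w⟧ : SockOrdering) = ρ ∧ ∀ a ∈ w, w.count a = r

/-- `ρ` contains `ρ'` as a (sock) pattern: some word representing `ρ` has a subsequence
representing `ρ'`. -/
def Contains (ρ ρ' : SockOrdering) : Prop :=
  ∃ w u : List ℕ, (⟦w⟧ : SockOrdering) = ρ ∧ u.Sublist w ∧ (⟦u⟧ : SockOrdering) = ρ'

/-- A word is stratified with `n` colors and `r` blocks: it is the concatenation of `r`
blocks of length `n`, each containing every color exactly once. -/
def StratifiedWord (n r : ℕ) (w : List ℕ) : Prop :=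
  ∃ blocks : List (List ℕ), blocks.length = r ∧ w = blocks.flatten ∧
    ∀ b ∈ blocks, b.length = n ∧ b.Nodup ∧ b.toFinset = w.toFinset

/-- An `r`-uniform stratified sock ordering with `n` colors. -/
def IsStratified (n r : ℕ) (ρ : SockOrdering) : Prop :=
  ∃ w : List ℕ, (⟦w⟧ : SockOrdering) = ρ ∧ StratifiedWord n r w

/-- The word `σ(1) σ(2) ⋯ σ(n)` (with values written in `{1,…,n}`). -/
def permWord (n : ℕ) (σ : Equiv.Perm (Fin n)) : List ℕ :=
  (List.finRange n).map fun i => (σ i : ℕ) + 1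

/-- The word `1 2 ⋯ n σ(1) σ(2) ⋯ σ(n)` representing the alignment-free 2-uniform sock
ordering associated with `σ`. -/
def afWord (n : ℕ) (σ : Equiv.Perm (Fin n)) : List ℕ :=
  ((List.finRange n).map fun i => (i : ℕ) + 1) ++ permWord n σ

/-- A word `w` contains the (permutation) pattern `p`: some subsequence of `w` of the same
length as `p` is order-isomorphic to `p`. -/
def ContainsPattern (w p : List ℕ) : Prop :=
  ∃ s : List ℕ, s.Sublist w ∧ s.length = p.length ∧
    ∀ i j, i < s.length → j < s.length →
      (s.getD i 0 < s.getD j 0 ↔ p.getD i 0 < p.getD j 0)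

def AvoidsPattern (w p : List ℕ) : Prop := ¬ ContainsPattern w p

/-- A word avoids the permutation patterns 123, 132, and 213. -/
def Avoids123_132_213 (w : List ℕ) : Prop :=
  AvoidsPattern w [1, 2, 3] ∧ AvoidsPattern w [1, 3, 2] ∧ AvoidsPattern w [2, 1, 3]

/-- A word avoids the pattern 231: there are no indices `i < j < k` with `w k < w i < w j`. -/
def Avoids231 (w : List ℕ) : Prop :=
  ¬ ∃ i j k, i < j ∧ j < k ∧ k < w.length ∧
    w.getD k 0 < w.getD i 0 ∧ w.getD i 0 < w.getD j 0

theorem StackStep.perm {s t : List ℕ × List ℕ × List ℕ} (h : StackStep s t) :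
    (s.1 ++ (s.2.1 ++ s.2.2)).Perm (t.1 ++ (t.2.1 ++ t.2.2)) := by
  cases h with
  | push a inp st out => exact List.perm_middle.symm
  | pop a inp st out =>
    refine List.Perm.append_left inp ?_
    rw [← List.append_assoc]
    exact (List.perm_append_singleton a (st ++ out)).symm

theorem IsStackOutput.perm {w out : List ℕ} (h : IsStackOutput w out) : w.Perm out := by
  have key : ∀ s t, Relation.ReflTransGen StackStep s t →
      (s.1 ++ (s.2.1 ++ s.2.2)).Perm (t.1 ++ (t.2.1 ++ t.2.2)) := by
    intro s t hst
    induction hst with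
    | refl => exact List.Perm.refl _
    | tail _ hstep ih => exact ih.trans hstep.perm
  simpa using key _ _ h

theorem IsStackOutput.map {w out : List ℕ} (h : IsStackOutput w out) (f : ℕ → ℕ) :
    IsStackOutput (w.map f) (out.map f) := by
  refine Relation.ReflTransGen.lift
    (fun s : List ℕ × List ℕ × List ℕ => (s.1.map f, s.2.1.map f, s.2.2.map f)) ?_ _ _ h
  intro s t hst
  cases hst with
  | push a inp st out => exact StackStep.push (f a) (inp.map f) (st.map f) (out.map f)
  | pop a inp st out => simpa [Function.onFun] using StackStep.pop (f a) (inp.map f) (st.map f) (out.map f)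

/-- Recolouring a word injectively does not change the sock ordering. -/
theorem sockEquiv_map {w : List ℕ} {f : ℕ → ℕ} (hf : Set.InjOn f {a | a ∈ w}) :
    SockEquiv (w.map f) w := by
  refine ⟨by simp, fun i j hi hj => ?_⟩
  rw [List.length_map] at hi hj
  simp only [List.getD_eq_getElem?_getD, List.getElem?_map, List.getElem?_eq_getElem hi,
    List.getElem?_eq_getElem hj, Option.map_some, Option.getD_some]
  exact hf.eq_iff (List.getElem_mem hi) (List.getElem_mem hj)

/-- Equivalent words differ by an injective recolouring. -/
theorem SockEquiv.exists_map {u v : List ℕ} (h : SockEquiv u v) :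
    ∃ f : ℕ → ℕ, Set.InjOn f {a | a ∈ u} ∧ u.map f = v := by
  obtain ⟨hl, he⟩ := h
  have idx : ∀ a ∈ u, u.idxOf a < u.length ∧ u.getD (u.idxOf a) 0 = a := by
    intro a ha
    have hlt := List.idxOf_lt_length_iff.2 ha
    exact ⟨hlt, by simp [hlt]⟩
  refine ⟨fun a => v.getD (u.idxOf a) 0, ?_, ?_⟩
  · intro a ha b hb hab
    obtain ⟨ha1, ha2⟩ := idx a ha
    obtain ⟨hb1, hb2⟩ := idx b hb
    rw [← ha2, ← hb2]
    exact (he _ _ ha1 hb1).2 hab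
  · refine List.ext_getElem (by simpa using hl) fun i hi hi' => ?_
    have hi₀ : i < u.length := by simpa using hi
    obtain ⟨h1, h2⟩ := idx _ (List.getElem_mem hi₀)
    have h3 := (he _ i h1 hi₀).1 (by rw [h2]; simp [hi₀])
    rw [List.getElem_map, h3]
    simp [hi']

/-- Run the stack procedure backwards from the final state with output `out`, undoing the
pushes (`U`) and pops (`D`) listed in chronological order. -/
def undoSteps (out : List ℕ) : List DyckStep → List ℕ × List ℕ × List ℕ
  | [] => ([], [], out)
  | .U :: p =>
    let s := undoSteps out p
    (s.2.1.headD 0 :: s.1, s.2.1.tail, s.2.2)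
  | .D :: p =>
    let s := undoSteps out p
    (s.1, s.2.2.getLastD 0 :: s.2.1, s.2.2.dropLast)

theorem exists_undoSteps {o : List ℕ} {s : List ℕ × List ℕ × List ℕ}
    (h : Relation.ReflTransGen StackStep s ([], [], o)) :
    ∃ p : List DyckStep, undoSteps o p = s ∧ p.count .U = s.1.length ∧
      p.count .D = p.count .U + s.2.1.length ∧
      ∀ i, (p.take i).count .D ≤ (p.take i).count .U + s.2.1.length := by
  induction h using Relation.ReflTransGen.head_induction_on with
  | refl => exact ⟨[], by simp [undoSteps]⟩
  | head hstep _ ih =>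
    obtain ⟨p, hp, hU, hD, hle⟩ := ih
    cases hstep with
    | push a inp st out =>
      refine ⟨.U :: p, by simp [undoSteps, hp], by simp_all, ?_, fun i => ?_⟩
      · simp only [List.count_cons_self, List.length_cons] at hD ⊢
        simp
        omega
      · cases i with
        | zero => simp
        | succ i =>
          have := hle i
          simp at this ⊢
          omega
    | pop a inp st out =>
      refine ⟨.D :: p, by simp [undoSteps, hp], by simp_all, ?_, fun i => ?_⟩
      · simp at hD ⊢
        omega
      · cases i with
        | zero => simp
        | succ i =>
          have := hle i
          simp at this ⊢
          omega

theorem IsStackOutput.exists_dyckWord {w out : List ℕ} (h : IsStackOutput w out) :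
    ∃ p : DyckWord, p.semilength = w.length ∧ (undoSteps out p.toList).1 = w := by
  obtain ⟨p, hp, hU, hD, hle⟩ := exists_undoSteps h
  exact ⟨⟨p, by simpa using hD.symm, by simpa using hle⟩, hU, by rw [hp]⟩

theorem exists_isStackOutput_of_mem_foot {κ : SockOrdering} {v : List ℕ}
    (h : (⟦v⟧ : SockOrdering) ∈ foot κ) :
    ∃ w, (⟦w⟧ : SockOrdering) = κ ∧ IsStackOutput w v := by
  obtain ⟨w, out, rfl, hwo, hout⟩ := h
  have hequiv : SockEquiv out v := Quotient.exact hout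
  obtain ⟨f, hf, rfl⟩ := hequiv.exists_map
  refine ⟨w.map f, Quotient.sound (sockEquiv_map fun a ha b hb => ?_), hwo.map f⟩
  exact hf (hwo.perm.subset ha) (hwo.perm.subset hb)

theorem length_eq_of_mem_foot {ρ κ : SockOrdering} (h : ρ ∈ foot κ) :
    κ.length = ρ.length := by
  obtain ⟨w, out, rfl, hwo, rfl⟩ := h
  exact hwo.perm.length_eq

theorem encard_dyckWord_semilength (n : ℕ) :
    {p : DyckWord | p.semilength = n}.encard = catalan n := by
  rw [← DyckWord.card_dyckWord_semilength_eq_catalan n, ← ENat.card_eq_coe_fintype_card]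
  rfl

theorem foot_preimage_encard_le_catalan (ρ : SockOrdering) :
    {κ : SockOrdering | ρ ∈ foot κ}.encard ≤ catalan ρ.length := by
  induction ρ using Quotient.inductionOn with
  | h v =>
    rw [← encard_dyckWord_semilength]
    refine le_trans (Set.encard_le_encard ?_)
      (Set.encard_image_le (fun p : DyckWord => (⟦(undoSteps v p.toList).1⟧ : SockOrdering)) _)
    intro κ hκ
    obtain ⟨w, rfl, hw⟩ := exists_isStackOutput_of_mem_foot hκ
    obtain ⟨p, hp, hpw⟩ := hw.exists_dyckWord
    exact ⟨p, hp.trans hw.perm.length_eq, congrArg _ hpw⟩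

theorem footIter_preimage_succ (ρ : SockOrdering) (k : ℕ) :
    {κ : SockOrdering | ρ ∈ footIter (k + 1) κ} =
      ⋃ μ ∈ {μ : SockOrdering | ρ ∈ foot μ}, {κ : SockOrdering | μ ∈ footIter k κ} := by
  ext κ
  simp [footIter, and_comm]

/-- `|foot⁻ᵏ(ρ)| ≤ C_N ^ k` where `N` is the length of `ρ`. -/
theorem footIter_preimage_encard_le_catalan_pow (ρ : SockOrdering) (k : ℕ) :
    {κ : SockOrdering | ρ ∈ footIter k κ}.encard ≤ (catalan ρ.length : ℕ∞) ^ k := by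
  induction k generalizing ρ with
  | zero => simp [footIter]
  | succ k ih =>
    have hcard := foot_preimage_encard_le_catalan ρ
    have hfin : {μ : SockOrdering | ρ ∈ foot μ}.Finite :=
      Set.finite_of_encard_le_coe hcard
    rw [footIter_preimage_succ, pow_succ']
    rw [hfin.encard_eq_coe_toFinset_card] at hcard
    calc _ ≤ ∑ μ ∈ hfin.toFinset, {κ : SockOrdering | μ ∈ footIter k κ}.encard := by
          simpa using hfin.toFinset.set_encard_biUnion_le
            fun μ => {κ : SockOrdering | μ ∈ footIter k κ}
      _ ≤ hfin.toFinset.card • (catalan ρ.length : ℕ∞) ^ k := by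
          refine Finset.sum_le_card_nsmul _ _ _ fun μ hμ => ?_
          rw [← length_eq_of_mem_foot (hfin.mem_toFinset.1 hμ)]
          exact ih μ
      _ ≤ _ := by
          rw [nsmul_eq_mul]
          gcongr
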